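/- arXiv:1011.4545 — 2 statements merged into one kernel-verified Lean document; each statement's English description precedes it below -/
import Mathlib

section
/- (Bootstrap lemma.) Let p > 1, A > 0, 0 < μ < 1 and λ > 0 satisfy (p^{−1/(p−1)} − p^{−p/(p−1)})·(1−μ)^{p/(p−1)}·λ^{−1/(p−1)} > A. Define φ(X) := A + μX + λX^p for X ≥ 0 and X_* := ((1−μ)/(pλ))^{1/(p−1)}. Then φ(X_*) < X_*, and there exist two real numbers X_−, X_+ with 0 < X_− < X_* < X_+ such that φ(X_−) = X_−, φ(X_+) = X_+, and every X ≥ 0 satisfying X ≤ φ(X) satisfies either X ≤ X_− or X ≥ X_+. -/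
theorem rpow_one_div_sub_one_rpow {p c : ℝ} (hp : 1 < p) (hc : 0 < c) :
    (c ^ (1 / (p - 1))) ^ p = c * c ^ (1 / (p - 1)) := by
  have hp1 : p - 1 ≠ 0 := by linarith
  rw [← Real.rpow_mul hc.le, show 1 / (p - 1) * p = 1 + 1 / (p - 1) by field_simp; ring,
    Real.rpow_add hc, Real.rpow_one]

theorem continuous_affine_add_rpow (A μ lam : ℝ) {p : ℝ} (hp : 0 ≤ p) :
    Continuous fun X : ℝ => A + μ * X + lam * X ^ p := by
  have := Real.continuous_rpow_const hp
  fun_prop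

theorem affine_add_rpow_lt_of_fixed_points {p A μ lam x y z : ℝ} (hp : 1 < p) (hlam : 0 < lam)
    (hx : 0 ≤ x) (hxz : x < z) (hzy : z < y) (hfx : A + μ * x + lam * x ^ p = x)
    (hfy : A + μ * y + lam * y ^ p = y) : A + μ * z + lam * z ^ p < z := by
  have hxy := hxz.trans hzy
  obtain ⟨a, b, ha, hb, hab, hz⟩ : z ∈ openSegment ℝ x y := by
    rw [openSegment_eq_Ioo hxy]
    exact ⟨hxz, hzy⟩
  have h := (strictConvexOn_rpow hp).2 (Set.mem_Ici.2 hx) (Set.mem_Ici.2 (hx.trans hxy.le))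
    hxy.ne ha hb hab
  simp only [smul_eq_mul] at h hz
  rw [hz] at h
  have hlt := mul_lt_mul_of_pos_left h hlam
  have hcomb : A + μ * z + lam * (a * x ^ p + b * y ^ p) = z := by
    rw [← hz]
    linear_combination a * hfx + b * hfy - A * hab
  linarith

theorem affine_add_rpow_threshold {p μ lam : ℝ} (hp : 1 < p) (hμ1 : μ < 1) (hlam : 0 < lam) :
    (p ^ (-1 / (p - 1)) - p ^ (-p / (p - 1))) * (1 - μ) ^ (p / (p - 1)) * lam ^ (-1 / (p - 1)) =
      (1 - μ) * (1 - 1 / p) * ((1 - μ) / (p * lam)) ^ (1 / (p - 1)) := by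
  have hp0 : 0 < p := by linarith
  have hp1 : p - 1 ≠ 0 := by linarith
  have hμ : 0 < 1 - μ := by linarith
  rw [Real.div_rpow hμ.le (by positivity), Real.mul_rpow hp0.le hlam.le,
    show -p / (p - 1) = -(1 / (p - 1)) - 1 by field_simp; ring,
    show p / (p - 1) = 1 + 1 / (p - 1) by field_simp; ring,
    show -1 / (p - 1) = -(1 / (p - 1)) by ring,
    Real.rpow_sub hp0, Real.rpow_add hμ, Real.rpow_one, Real.rpow_one,
    Real.rpow_neg hp0.le, Real.rpow_neg hlam.le]
  field_simp


/-- bootstrap lemma. If `p > 1`, `A > 0`, `0 < μ < 1`, `λ > 0` and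
`(p^{−1/(p−1)} − p^{−p/(p−1)})·(1−μ)^{p/(p−1)}·λ^{−1/(p−1)} > A`, then setting
`φ(X) = A + μX + λX^p` and `X_* = ((1−μ)/(pλ))^{1/(p−1)}` one has `φ(X_*) < X_*`,
and there are fixed points `0 < X_− < X_* < X_+` of `φ` such that any `X ≥ 0` with
`X ≤ φ(X)` satisfies `X ≤ X_−` or `X ≥ X_+`. -/
theorem bootstrap_lemma (p A μ lam : ℝ)
    (hp : 1 < p) (hA : 0 < A) (hμ0 : 0 < μ) (hμ1 : μ < 1) (hlam : 0 < lam)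
    (hcond : (p ^ (-1 / (p - 1)) - p ^ (-p / (p - 1))) * (1 - μ) ^ (p / (p - 1)) *
        lam ^ (-1 / (p - 1)) > A) :
    let φ : ℝ → ℝ := fun X => A + μ * X + lam * X ^ p
    let Xstar : ℝ := ((1 - μ) / (p * lam)) ^ (1 / (p - 1))
    φ Xstar < Xstar ∧
      ∃ Xminus Xplus : ℝ, 0 < Xminus ∧ Xminus < Xstar ∧ Xstar < Xplus ∧
        φ Xminus = Xminus ∧ φ Xplus = Xplus ∧
        ∀ X : ℝ, 0 ≤ X → X ≤ φ X → X ≤ Xminus ∨ X ≥ Xplus := by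
  intro φ Xstar
  have hp0 : 0 < p := by linarith
  have hμ : 0 < 1 - μ := by linarith
  have hexp : 0 < 1 / (p - 1) := one_div_pos.2 (by linarith)
  have hc : 0 < (1 - μ) / (p * lam) := by positivity
  have hXpos : 0 < Xstar := Real.rpow_pos_of_pos hc _
  have hstar : φ Xstar < Xstar := by
    rw [affine_add_rpow_threshold hp hμ1 hlam] at hcond
    have hpow : Xstar ^ p = (1 - μ) / (p * lam) * Xstar := rpow_one_div_sub_one_rpow hp hc
    change A + μ * Xstar + lam * Xstar ^ p < Xstar
    change (1 - μ) * (1 - 1 / p) * Xstar > A at hcond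
    rw [hpow]
    have hsimp : lam * ((1 - μ) / (p * lam) * Xstar) = (1 - μ) * (1 / p) * Xstar := by field_simp
    rw [hsimp]
    linarith
  have hcont : Continuous φ := continuous_affine_add_rpow A μ lam hp0.le
  have hdiff : Continuous fun X => φ X - X := hcont.sub continuous_id
  have hzero : 0 < φ 0 - 0 := by simpa [φ, Real.zero_rpow hp0.ne'] using hA
  obtain ⟨Y, hXY, hY⟩ : ∃ Y, Xstar < Y ∧ Y < φ Y := by
    have hinv : 0 < 1 / lam := by positivity
    have hYpos : 0 < (1 / lam) ^ (1 / (p - 1)) := Real.rpow_pos_of_pos hinv _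
    refine ⟨(1 / lam) ^ (1 / (p - 1)), Real.rpow_lt_rpow hc.le ?_ hexp, ?_⟩
    · rw [div_lt_div_iff₀ (by positivity) hlam]
      nlinarith
    · change _ < A + μ * _ + lam * _ ^ p
      rw [rpow_one_div_sub_one_rpow hp hinv, ← mul_assoc, mul_one_div_cancel hlam.ne', one_mul]
      nlinarith [mul_pos hμ0 hYpos]
  obtain ⟨x, ⟨hx0, hxX⟩, hfx⟩ := intermediate_value_Ioo' hXpos.le hdiff.continuousOn
    (show (0 : ℝ) ∈ Set.Ioo _ _ from ⟨sub_neg.2 hstar, hzero⟩)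
  obtain ⟨y, ⟨hXy, -⟩, hfy⟩ := intermediate_value_Ioo hXY.le hdiff.continuousOn
    (show (0 : ℝ) ∈ Set.Ioo _ _ from ⟨sub_neg.2 hstar, sub_pos.2 hY⟩)
  have hfx : φ x = x := sub_eq_zero.1 hfx
  have hfy : φ y = y := sub_eq_zero.1 hfy
  refine ⟨hstar, x, y, hx0, hxX, hXy, hfx, hfy, fun X _ hX => ?_⟩
  by_contra! h
  exact hX.not_gt (affine_add_rpow_lt_of_fixed_points hp hlam hx0.le h.1 h.2 hfx hfy)
end

section
/- (Bohm potential identity.) Let ρ : ℝ² → ℝ be a C³ function with ρ(x) > 0 for all x ∈ ℝ². Then for each j ∈ {1,2} and all x ∈ ℝ²: (1/2)·ρ(x)·∂_j( Δ√ρ / √ρ )(x) = (1/4)·∂_j(Δρ)(x) − Σ_{k=1}^{2} ∂_k( ∂_k√ρ · ∂_j√ρ )(x), where √ρ denotes the function x ↦ √(ρ(x)) and Δ is the Laplacian on ℝ². -/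
/-- Partial derivative in direction `j` of a real-valued function on `ℝ²`. -/
noncomputable def pd (j : Fin 2) (f : (Fin 2 → ℝ) → ℝ) : (Fin 2 → ℝ) → ℝ :=
  fun x => fderiv ℝ f x (Pi.single j (1 : ℝ))

/-- Laplacian of a real-valued function on `ℝ²`. -/
noncomputable def lap (f : (Fin 2 → ℝ) → ℝ) : (Fin 2 → ℝ) → ℝ :=
  fun x => ∑ k : Fin 2, pd k (pd k f) x

theorem pd_add {f g : (Fin 2 → ℝ) → ℝ} (hf : Differentiable ℝ f) (hg : Differentiable ℝ g)
    (j : Fin 2) : pd j (fun y => f y + g y) = fun x => pd j f x + pd j g x := by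
  funext x
  simp [pd, fderiv_fun_add (hf x) (hg x)]

theorem pd_mul {f g : (Fin 2 → ℝ) → ℝ} (hf : Differentiable ℝ f) (hg : Differentiable ℝ g)
    (j : Fin 2) : pd j (fun y => f y * g y) = fun x => pd j f x * g x + f x * pd j g x := by
  funext x
  simp only [pd, fderiv_fun_mul (hf x) (hg x), _root_.add_apply,
    _root_.smul_apply, smul_eq_mul]
  ring

theorem pd_div_mul_sq {f g : (Fin 2 → ℝ) → ℝ} (hf : Differentiable ℝ f)
    (hg : Differentiable ℝ g) (h0 : ∀ x, g x ≠ 0) (j : Fin 2) (x : Fin 2 → ℝ) :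
    g x * g x * pd j (fun y => f y / g y) x = g x * pd j f x - f x * pd j g x := by
  have hq : Differentiable ℝ (fun y => f y / g y) := by
    simpa only [div_eq_mul_inv] using hf.fun_mul (hg.fun_inv h0)
  have h : pd j f x = pd j (fun y => f y / g y) x * g x + f x / g x * pd j g x := by
    rw [← congrFun (pd_mul hq hg j) x]
    congr 2
    funext y
    rw [div_mul_cancel₀ _ (h0 y)]
  have := h0 x
  rw [h]
  field_simp
  ring

theorem contDiff_pd {f : (Fin 2 → ℝ) → ℝ} {m n : WithTop ℕ∞} (hf : ContDiff ℝ n f)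
    (hmn : m + 1 ≤ n) (j : Fin 2) : ContDiff ℝ m (pd j f) :=
  (hf.fderiv_right hmn).clm_apply contDiff_const

theorem pd_comm {f : (Fin 2 → ℝ) → ℝ} (hf : ContDiff ℝ 2 f) (j k : Fin 2) :
    pd j (pd k f) = pd k (pd j f) := by
  have hd : Differentiable ℝ (fderiv ℝ f) :=
    (hf.fderiv_right (m := 1) (by norm_num)).differentiable (by norm_num)
  have key : ∀ (a b : Fin 2) (x : Fin 2 → ℝ),
      pd a (pd b f) x = fderiv ℝ (fderiv ℝ f) x (Pi.single a 1) (Pi.single b 1) := by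
    intro a b x
    change fderiv ℝ (fun y => fderiv ℝ f y (Pi.single b 1)) x (Pi.single a 1) = _
    rw [fderiv_clm_apply (hd x) (differentiableAt_const _)]
    simp
  funext x
  rw [key, key]
  exact hf.contDiffAt.isSymmSndFDerivAt (by simp) _ _

/-- The Bohm potential identity in terms of the amplitude `u = √ρ`. -/
theorem bohm_potential_identity_amplitude {u : (Fin 2 → ℝ) → ℝ} (hu : ContDiff ℝ 3 u)
    (h0 : ∀ x, u x ≠ 0) (j : Fin 2) (x : Fin 2 → ℝ) :
    (1 / 2) * (u x * u x) * pd j (fun y => lap u y / u y) x =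
      (1 / 4) * pd j (lap fun y => u y * u y) x -
        ∑ k : Fin 2, pd k (fun y => pd k u y * pd j u y) x := by
  have d0 : Differentiable ℝ u := hu.differentiable (by norm_num)
  have c1 : ∀ k, ContDiff ℝ 2 (pd k u) := contDiff_pd hu (by norm_num)
  have c2 : ∀ k l, ContDiff ℝ 1 (pd k (pd l u)) := fun k l => contDiff_pd (c1 l) (by norm_num) k
  have d1 : ∀ k, Differentiable ℝ (pd k u) := fun k => (c1 k).differentiable (by norm_num)
  have d2 : ∀ k l, Differentiable ℝ (pd k (pd l u)) :=
    fun k l => (c2 k l).differentiable (by norm_num)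
  have hlap : lap u = fun y => pd 0 (pd 0 u) y + pd 1 (pd 1 u) y := by
    funext y
    simp [lap]
  have dlap : Differentiable ℝ (lap u) := hlap ▸ (d2 0 0).fun_add (d2 1 1)
  have hsq : (lap fun y => u y * u y) = fun y =>
      ((pd 0 u y * pd 0 u y + pd 1 u y * pd 1 u y) + u y * lap u y) +
        ((pd 0 u y * pd 0 u y + pd 1 u y * pd 1 u y) + u y * lap u y) := by
    funext y
    simp only [lap, Fin.sum_univ_two, pd_mul d0 d0, pd_add ((d1 _).fun_mul d0) (d0.fun_mul (d1 _)),
      pd_mul (d1 _) d0, pd_mul d0 (d1 _)]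
    ring
  have dgrad : Differentiable ℝ fun y => pd 0 u y * pd 0 u y + pd 1 u y * pd 1 u y :=
    ((d1 0).fun_mul (d1 0)).fun_add ((d1 1).fun_mul (d1 1))
  have dul : Differentiable ℝ fun y => u y * lap u y := d0.fun_mul dlap
  rw [mul_assoc, pd_div_mul_sq dlap d0 h0, hsq, pd_add (dgrad.fun_add dul) (dgrad.fun_add dul),
    pd_add dgrad dul, pd_add ((d1 0).fun_mul (d1 0)) ((d1 1).fun_mul (d1 1)), pd_mul d0 dlap]
  simp only [Fin.sum_univ_two, pd_mul (d1 _) (d1 _), pd_comm (hu.of_le (by norm_num)) _ j]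
  rw [congrFun hlap x]
  ring

/-- Bohm potential identity: for `ρ ∈ C³(ℝ²)` strictly positive,
`(1/2)·ρ·∂_j(Δ√ρ/√ρ) = (1/4)·∂_j(Δρ) − Σ_k ∂_k(∂_k√ρ·∂_j√ρ)`. -/
theorem bohm_potential_identity
    (ρ : (Fin 2 → ℝ) → ℝ) (hρ : ContDiff ℝ 3 ρ) (hpos : ∀ x, 0 < ρ x) :
    ∀ (j : Fin 2) (x : Fin 2 → ℝ),
      (1 / 2) * ρ x * pd j (fun y => lap (fun z => Real.sqrt (ρ z)) y / Real.sqrt (ρ y)) x =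
        (1 / 4) * pd j (lap ρ) x -
          ∑ k : Fin 2,
            pd k (fun y => pd k (fun z => Real.sqrt (ρ z)) y *
              pd j (fun z => Real.sqrt (ρ z)) y) x := by
  intro j x
  have hu : ContDiff ℝ 3 fun z => Real.sqrt (ρ z) := hρ.sqrt fun z => (hpos z).ne'
  have hsq : ρ = fun z => Real.sqrt (ρ z) * Real.sqrt (ρ z) :=
    funext fun z => (Real.mul_self_sqrt (hpos z).le).symm
  have key := bohm_potential_identity_amplitude hu (fun z => (Real.sqrt_pos.2 (hpos z)).ne') j x
  rwa [← hsq, Real.mul_self_sqrt (hpos x).le] at key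
end
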